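/- arXiv:1005.1975 — 2 statements merged into one kernel-verified Lean document; each statement's English description precedes it below -/
import Mathlib

section
/- Characterization of perfect weak mutual independence: a pure state |ψ⟩ on systems a ⊗ α ⊗ B ⊗ E satisfies ρ_{aE} = ρ_a ⊗ ρ_E if and only if there exists an isometry U : H_α ⊗ H_B → H_{ā} ⊗ H_{Ē} (into possibly enlarged spaces) such that (1_a ⊗ U ⊗ 1_E)|ψ⟩ = |φ⟩_{a ā} ⊗ |χ⟩_{E Ē} for some pure states |φ⟩, |χ⟩. -/
open Matrix BigOperators

theorem exists_isom_of_gram {I L : Type*} [Fintype I] [Fintype L]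
    (v w : I → EuclideanSpace ℂ L)
    (h : ∀ i j, inner ℂ (v i) (v j) = inner ℂ (w i) (w j)) :
    ∃ T : EuclideanSpace ℂ L →ₗᵢ[ℂ] EuclideanSpace ℂ L, ∀ i, T (v i) = w i := by
  classical
  let A := Fintype.linearCombination ℂ v
  let B := Fintype.linearCombination ℂ w
  have hin : ∀ c, inner ℂ (A c) (A c) = inner ℂ (B c) (B c) := by
    intro c
    simp only [A, B, Fintype.linearCombination_apply, sum_inner, inner_sum, inner_smul_left,
      inner_smul_right, h]
  have hn : ∀ c, ‖A c‖ = ‖B c‖ := by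
    intro c
    rw [@norm_eq_sqrt_re_inner ℂ, @norm_eq_sqrt_re_inner ℂ, hin]
  obtain ⟨g, hg⟩ := LinearMap.exists_rightInverse_of_surjective A.rangeRestrict
    A.range_rangeRestrict
  have hg' : ∀ s, A (g s) = (s : EuclideanSpace ℂ L) := by
    intro s
    have := congrArg Subtype.val (LinearMap.congr_fun hg s)
    simpa using this
  let T0 : LinearMap.range A →ₗᵢ[ℂ] EuclideanSpace ℂ L :=
    { toLinearMap := B ∘ₗ g
      norm_map' := by
        intro s
        have := hn (g s)
        rw [hg'] at this
        exact this.symm }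
  refine ⟨T0.extend, fun i => ?_⟩
  have hv : A (Pi.single i 1) = v i := by simp [A]
  have hw : B (Pi.single i 1) = w i := by simp [B]
  have e := T0.extend_apply ⟨A (Pi.single i 1), LinearMap.mem_range_self _ _⟩
  have k : B (g ⟨A (Pi.single i 1), LinearMap.mem_range_self _ _⟩) = B (Pi.single i 1) := by
    rw [← sub_eq_zero, ← map_sub, ← norm_eq_zero, ← hn, map_sub, hg']
    simp
  rw [← hv, ← hw, ← k]
  exact e

theorem exists_isom_matrix {I K L : Type*} [Fintype I] [Fintype K] [Fintype L] [DecidableEq K]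
    [DecidableEq L] (J : K ↪ L)
    (M : Matrix K I ℂ) (N : Matrix L I ℂ) (h : Mᴴ * M = Nᴴ * N) :
    ∃ U : Matrix L K ℂ, Uᴴ * U = 1 ∧ U * M = N := by
  let P : Matrix L K ℂ := Matrix.of fun l k => if J k = l then 1 else 0
  have hP : Pᴴ * P = 1 := by
    ext a b
    simp only [Matrix.mul_apply, Matrix.one_apply, Matrix.conjTranspose_apply]
    simp [P, eq_comm]
  have key : (P * M)ᴴ * (P * M) = Nᴴ * N := by
    rw [Matrix.conjTranspose_mul, Matrix.mul_assoc, ← Matrix.mul_assoc Pᴴ, hP, Matrix.one_mul, h]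
  obtain ⟨T, hT⟩ := exists_isom_of_gram (fun i => WithLp.toLp 2 fun l => (P * M) l i)
    (fun i => WithLp.toLp 2 fun l => N l i) (by
      intro i j
      have := congrFun (congrFun key i) j
      simp only [Matrix.mul_apply (M := (P * M)ᴴ), Matrix.mul_apply (M := Nᴴ),
        Matrix.conjTranspose_apply] at this
      simpa [PiLp.inner_apply, mul_comm] using this)
  let V : Matrix L L ℂ := Matrix.of fun a b => T (EuclideanSpace.single b 1) a
  have hV : Vᴴ * V = 1 := by
    ext a b
    have := T.inner_map_map (EuclideanSpace.single a 1) (EuclideanSpace.single b (1:ℂ))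
    rw [PiLp.inner_apply] at this
    simp only [Matrix.mul_apply, Matrix.conjTranspose_apply, V, Matrix.one_apply, Matrix.of_apply]
    simpa [mul_comm, EuclideanSpace.inner_single_left, Pi.single_apply, eq_comm] using this
  have hVT : ∀ (c : L → ℂ) (a : L), T (WithLp.toLp 2 c) a = ∑ b, V a b * c b := by
    intro c a
    have : WithLp.toLp 2 c = ∑ b, c b • EuclideanSpace.single b (1:ℂ) := by
      ext l
      simp [Pi.single_apply]
    rw [this, map_sum]
    simp [V, mul_comm]
  refine ⟨V * P, ?_, ?_⟩
  · rw [Matrix.conjTranspose_mul, Matrix.mul_assoc, ← Matrix.mul_assoc Vᴴ, hV, Matrix.one_mul, hP]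
  · rw [Matrix.mul_assoc]
    ext a i
    rw [Matrix.mul_apply, ← hVT (fun l => (P * M) l i), hT]

/-- Characterization of perfect weak mutual independence: for a pure state ψ on
    a ⊗ α ⊗ B ⊗ E, the reduced state satisfies ρ_{aE} = ρ_a ⊗ ρ_E if and only if there is
    an isometry U : H_α ⊗ H_B → H_ā ⊗ H_Ē (into possibly enlarged spaces) mapping ψ to a
    product of pure states |φ⟩_{aā} ⊗ |χ⟩_{EĒ}. -/
theorem perfect_weak_mutual_independence_characterization
    {Ia Iα IB IE : Type*} [Fintype Ia] [DecidableEq Ia] [Fintype Iα] [DecidableEq Iα]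
    [Fintype IB] [DecidableEq IB] [Fintype IE] [DecidableEq IE]
    (ψ : Ia × Iα × IB × IE → ℂ) (hψ : ∑ x, ‖ψ x‖ ^ 2 = 1) :
    ((∀ (x x' : Ia) (e e' : IE),
        (∑ y : Iα, ∑ b : IB, ψ (x, y, b, e) * star (ψ (x', y, b, e')))
          = (∑ y : Iα, ∑ b : IB, ∑ f : IE, ψ (x, y, b, f) * star (ψ (x', y, b, f)))
            * (∑ z : Ia, ∑ y : Iα, ∑ b : IB, ψ (z, y, b, e) * star (ψ (z, y, b, e'))))
      ↔
      ∃ (n1 n2 : ℕ) (U : Matrix (Fin n1 × Fin n2) (Iα × IB) ℂ),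
        Uᴴ * U = 1 ∧
        ∃ (φ : Ia × Fin n1 → ℂ) (χ : IE × Fin n2 → ℂ),
          (∑ p, ‖φ p‖ ^ 2 = 1) ∧ (∑ p, ‖χ p‖ ^ 2 = 1) ∧
          ∀ (x : Ia) (u : Fin n1) (v : Fin n2) (e : IE),
            (∑ y : Iα, ∑ b : IB, U (u, v) (y, b) * ψ (x, y, b, e))
              = φ (x, u) * χ (e, v)) := by
  constructor
  · intro h
    have hne : Nonempty (Ia × Iα × IB × IE) := by
      by_contra hc
      rw [not_nonempty_iff] at hc
      simp at hψ
    obtain ⟨x0, y0, b0, e0⟩ := hne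
    let E1 := Fintype.equivFin (Iα × IB × IE)
    let E2 := Fintype.equivFin (Ia × Iα × IB)
    let J : Iα × IB ↪ Fin (Fintype.card (Iα × IB × IE)) × Fin (Fintype.card (Ia × Iα × IB)) :=
      ⟨fun p => (E1 (p.1, p.2, e0), E2 (x0, y0, b0)), by
        intro p q hpq
        simpa [Prod.ext_iff] using hpq⟩
    let φ : Ia × Fin (Fintype.card (Iα × IB × IE)) → ℂ := fun p =>
      ψ (p.1, (E1.symm p.2).1, (E1.symm p.2).2.1, (E1.symm p.2).2.2)
    let χ : IE × Fin (Fintype.card (Ia × Iα × IB)) → ℂ := fun p =>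
      ψ ((E2.symm p.2).1, (E2.symm p.2).2.1, (E2.symm p.2).2.2, p.1)
    have hφ : ∀ x x', ∑ u, φ (x, u) * star (φ (x', u)) =
        ∑ y : Iα, ∑ b : IB, ∑ f : IE, ψ (x, y, b, f) * star (ψ (x', y, b, f)) := by
      intro x x'
      simp only [φ]
      rw [Equiv.sum_comp E1.symm (fun t => ψ (x, t.1, t.2.1, t.2.2) *
        star (ψ (x', t.1, t.2.1, t.2.2)))]
      simp only [Fintype.sum_prod_type]
    have hχ : ∀ e e', ∑ u, χ (e, u) * star (χ (e', u)) =
        ∑ z : Ia, ∑ y : Iα, ∑ b : IB, ψ (z, y, b, e) * star (ψ (z, y, b, e')) := by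
      intro e e'
      simp only [χ]
      rw [Equiv.sum_comp E2.symm (fun t => ψ (t.1, t.2.1, t.2.2, e) *
        star (ψ (t.1, t.2.1, t.2.2, e')))]
      simp only [Fintype.sum_prod_type]
    obtain ⟨U, hU, hUM⟩ := exists_isom_matrix J
      (Matrix.of fun (p : Iα × IB) (q : Ia × IE) => ψ (q.1, p.1, p.2, q.2))
      (Matrix.of fun p (q : Ia × IE) => φ (q.1, p.1) * χ (q.2, p.2)) (by
        ext ⟨x', e'⟩ ⟨x, e⟩
        have := h x x' e e'
        rw [← hφ, ← hχ, Finset.sum_mul_sum] at this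
        simp only [Matrix.mul_apply, Matrix.conjTranspose_apply, Fintype.sum_prod_type, Matrix.of_apply]
        simp only [mul_comm (star (ψ _))]
        rw [this]
        refine Finset.sum_congr rfl fun u _ => Finset.sum_congr rfl fun v _ => ?_
        rw [star_mul]
        ring)
    refine ⟨_, _, U, hU, φ, χ, ?_, ?_, ?_⟩
    · rw [← hψ]
      simp only [Fintype.sum_prod_type, φ]
      refine Finset.sum_congr rfl fun x _ => ?_
      rw [Equiv.sum_comp E1.symm (fun t => ‖ψ (x, t.1, t.2.1, t.2.2)‖ ^ 2)]
      simp only [Fintype.sum_prod_type]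
    · rw [← hψ, Fintype.sum_prod_type]
      simp only [χ]
      have : ∀ e, ∑ u, ‖ψ ((E2.symm u).1, (E2.symm u).2.1, (E2.symm u).2.2, e)‖ ^ 2 =
          ∑ t : Ia × Iα × IB, ‖ψ (t.1, t.2.1, t.2.2, e)‖ ^ 2 := fun e =>
        Equiv.sum_comp E2.symm (fun t => ‖ψ (t.1, t.2.1, t.2.2, e)‖ ^ 2)
      simp only [this]
      rw [Finset.sum_comm]
      simp only [Fintype.sum_prod_type]
    · intro x u v e
      have := congrFun (congrFun hUM (u, v)) (x, e)
      simpa only [Matrix.mul_apply, Matrix.of_apply, Fintype.sum_prod_type] using this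
  · rintro ⟨n1, n2, U, hU, φ, χ, hφ, hχ, h⟩
    let M : Matrix (Iα × IB) (Ia × IE) ℂ := Matrix.of fun p q => ψ (q.1, p.1, p.2, q.2)
    let N : Matrix (Fin n1 × Fin n2) (Ia × IE) ℂ := Matrix.of fun p q => φ (q.1, p.1) * χ (q.2, p.2)
    have hUM : U * M = N := by
      ext ⟨u, v⟩ ⟨x, e⟩
      simpa only [Matrix.mul_apply, Matrix.of_apply, M, N, Fintype.sum_prod_type] using h x u v e
    have hG : Mᴴ * M = Nᴴ * N := by
      rw [← hUM, Matrix.conjTranspose_mul, Matrix.mul_assoc, ← Matrix.mul_assoc Uᴴ, hU,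
        Matrix.one_mul]
    have g : ∀ x x' e e', (∑ y : Iα, ∑ b : IB, ψ (x, y, b, e) * star (ψ (x', y, b, e'))) =
        (∑ u, φ (x, u) * star (φ (x', u))) * ∑ v, χ (e, v) * star (χ (e', v)) := by
      intro x x' e e'
      have := congrFun (congrFun hG (x', e')) (x, e)
      simp only [Matrix.mul_apply, Matrix.conjTranspose_apply, Fintype.sum_prod_type, M, N,
        Matrix.of_apply] at this
      simp only [mul_comm (ψ _) (star _)]
      rw [this, Finset.sum_mul_sum]
      refine Finset.sum_congr rfl fun u _ => Finset.sum_congr rfl fun v _ => ?_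
      rw [star_mul]
      ring
    have t1 : ∑ x, ∑ u, φ (x, u) * star (φ (x, u)) = 1 := by
      rw [Fintype.sum_prod_type] at hφ
      have := congrArg (fun r : ℝ => (r : ℂ)) hφ
      push_cast at this
      simpa [Complex.mul_conj'] using this
    have t2 : ∑ x, ∑ u, χ (x, u) * star (χ (x, u)) = 1 := by
      rw [Fintype.sum_prod_type] at hχ
      have := congrArg (fun r : ℝ => (r : ℂ)) hχ
      push_cast at this
      simpa [Complex.mul_conj'] using this
    intro x x' e e'
    have r1 : ∑ y : Iα, ∑ b : IB, ∑ f : IE, ψ (x, y, b, f) * star (ψ (x', y, b, f)) =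
        ∑ f : IE, ∑ y : Iα, ∑ b : IB, ψ (x, y, b, f) * star (ψ (x', y, b, f)) := by
      rw [Finset.sum_comm (s := (Finset.univ : Finset IE))]
      refine Finset.sum_congr rfl fun y _ => Finset.sum_comm
    rw [r1]
    simp only [g]
    rw [← Finset.mul_sum, ← Finset.sum_mul, t1, t2, mul_one, one_mul]
end

section
/- Monotonicity under local processing on Bob's side: for any density matrix ρ on H_A ⊗ H_B and any CPTP map Λ : B → B', the mutual information satisfies I(A:B')_{(1⊗Λ)(ρ)} ≤ I(A:B)_ρ. -/
open Matrix BigOperators ComplexOrder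

/-- Von Neumann entropy of a matrix (via eigenvalues when Hermitian, 0 otherwise). -/
noncomputable def vNEntropy {n : Type*} [Fintype n] [DecidableEq n] (ρ : Matrix n n ℂ) : ℝ :=
  if h : ρ.IsHermitian then -∑ i, h.eigenvalues i * Real.log (h.eigenvalues i) else 0

/-- A density matrix: positive semidefinite with unit trace. -/
def IsDensityMatrix {n : Type*} [Fintype n] (ρ : Matrix n n ℂ) : Prop :=
  ρ.PosSemidef ∧ ρ.trace = 1

/-- Complete positivity: id_k ⊗ Φ preserves positive semidefiniteness for every k. -/
def IsCompletelyPositive {n m : Type*} [Fintype n] [DecidableEq n] [Fintype m] [DecidableEq m]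
    (Φ : Matrix n n ℂ →ₗ[ℂ] Matrix m m ℂ) : Prop :=
  ∀ (k : ℕ) (ρ : Matrix (Fin k × n) (Fin k × n) ℂ), ρ.PosSemidef →
    Matrix.PosSemidef
      (fun p q : Fin k × m => Φ (fun a b => ρ (p.1, a) (q.1, b)) p.2 q.2)

/-- Trace preservation. -/
def IsTracePreserving {n m : Type*} [Fintype n] [Fintype m]
    (Φ : Matrix n n ℂ →ₗ[ℂ] Matrix m m ℂ) : Prop :=
  ∀ ρ : Matrix n n ℂ, (Φ ρ).trace = ρ.trace

open scoped Kronecker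
open Filter Topology

lemma dpi_deriv {K : Type*} [Fintype K] (c p q : K → ℝ)
    (hs : ∀ i, c i ≠ 0 → 0 < p i ∧ 0 < q i) (t : ℝ) (ht : 0 ≤ t) :
    HasDerivAt (fun t => ∑ i, c i * Real.log (q i + t * p i))
        (∑ i, c i * (p i / (q i + t * p i))) t := by
  apply HasDerivAt.fun_sum
  intro i _
  by_cases hc : c i = 0
  · simp only [hc, zero_mul]; exact hasDerivAt_const _ _
  · obtain ⟨h1, h2⟩ := hs i hc
    apply HasDerivAt.const_mul
    apply HasDerivAt.log _ (by positivity)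
    simpa using ((hasDerivAt_id t).mul_const (p i)).const_add (q i)

lemma dpi_lim {K : Type*} [Fintype K] (c p q : K → ℝ)
    (hs : ∀ i, c i ≠ 0 → 0 < p i ∧ 0 < q i) :
    Tendsto (fun t : ℝ => ∑ i, c i * (Real.log (q i + t * p i) - Real.log t)) atTop
        (𝓝 (∑ i, c i * Real.log (p i))) := by
  apply tendsto_finsetSum
  intro i _
  by_cases hc : c i = 0
  · simp [hc]
  · obtain ⟨h1, h2⟩ := hs i hc
    apply Tendsto.const_mul
    have : Tendsto (fun t : ℝ => Real.log (q i * t⁻¹ + p i)) atTop (𝓝 (Real.log (p i))) := by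
      apply Tendsto.log _ h1.ne'
      simpa using (tendsto_inv_atTop_zero.const_mul (q i)).add_const (p i)
    refine this.congr' ?_
    filter_upwards [eventually_gt_atTop 0] with t ht
    rw [← Real.log_div (by positivity) (by positivity)]
    congr 1; field_simp

lemma dpi_analysis {I J : Type*} [Fintype I] [Fintype J]
    (c p q : I → ℝ) (c' p' q' : J → ℝ)
    (hs : ∀ i, c i ≠ 0 → 0 < p i ∧ 0 < q i) (hs' : ∀ i, c' i ≠ 0 → 0 < p' i ∧ 0 < q' i)
    (hsum : ∑ i, c i = ∑ j, c' j)
    (h : ∀ t : ℝ, 0 < t → ∑ j, c' j * (p' j / (q' j + t * p' j)) ≤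
      ∑ i, c i * (p i / (q i + t * p i))) :
    ∑ j, c' j * (Real.log (p' j) - Real.log (q' j)) ≤
      ∑ i, c i * (Real.log (p i) - Real.log (q i)) := by
  have hd := fun t ht => (dpi_deriv c p q hs t ht).sub (dpi_deriv c' p' q' hs' t ht)
  have mono : MonotoneOn ((fun t => ∑ i, c i * Real.log (q i + t * p i)) -
      fun t => ∑ i, c' i * Real.log (q' i + t * p' i)) (Set.Ici (0:ℝ)) := by
    apply monotoneOn_of_deriv_nonneg (convex_Ici 0)
    · exact fun t ht => (hd t ht).continuousAt.continuousWithinAt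
    · intro t ht
      rw [interior_Ici] at ht
      exact (hd t (le_of_lt ht)).differentiableAt.differentiableWithinAt
    · intro t ht
      rw [interior_Ici] at ht
      rw [(hd t (le_of_lt ht)).deriv]
      linarith [h t ht]
  have hl := (dpi_lim c p q hs).sub (dpi_lim c' p' q' hs')
  have := ge_of_tendsto (b := ∑ i, c i * Real.log (q i) - ∑ i, c' i * Real.log (q' i)) hl (by
    filter_upwards [eventually_ge_atTop 0] with t ht
    have := mono (Set.mem_Ici.2 le_rfl) (Set.mem_Ici.2 ht) ht
    simp only [Pi.sub_apply, zero_mul, add_zero] at this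
    simp only [mul_sub, Finset.sum_sub_distrib, ← Finset.sum_mul, hsum]
    linarith)
  simp only [mul_sub, Finset.sum_sub_distrib]
  linarith

open scoped MatrixOrder Matrix.Norms.L2Operator in
lemma dpi_sq {n : Type*} [Fintype n] [DecidableEq n] (ρ : Matrix n n ℂ) (h : ρ.PosSemidef) :
    ∃ M : Matrix n n ℂ, ρ = Mᴴ * M :=
  CStarAlgebra.nonneg_iff_eq_star_mul_self.mp h.nonneg

lemma dpi_kraus {n m : Type*} [Fintype n] [DecidableEq n] [Fintype m] [DecidableEq m]
    (Φ : Matrix n n ℂ →ₗ[ℂ] Matrix m m ℂ)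
    (hCP : IsCompletelyPositive Φ) (hTP : IsTracePreserving Φ) :
    ∃ K : (n × m) → Matrix m n ℂ, (∀ X, Φ X = ∑ k, K k * X * (K k)ᴴ) ∧
      ∑ k, (K k)ᴴ * K k = 1 := by
  classical
  let e := Fintype.equivFin n
  let v : Fin (Fintype.card n) × n → ℂ := fun x => if e.symm x.1 = x.2 then 1 else 0
  have hC := hCP (Fintype.card n) (vecMulVec v (star v)) (posSemidef_vecMulVec_self_star v)
  have hC2 := hC.submatrix (fun x : n × m => (e x.1, x.2))
  obtain ⟨M, hM⟩ := dpi_sq _ hC2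
  have hM' : ∀ a b x y, Φ (Matrix.single a b 1) x y = ∑ k, star (M k (a, x)) * M k (b, y) := by
    intro a b x y
    have := congrFun (congrFun hM (a, x)) (b, y)
    simp only [mul_apply, conjTranspose_apply] at this
    rw [← this]
    have h0 : Matrix.single a b (1:ℂ) =
        fun c d => vecMulVec v (star v) (e a, c) (e b, d) := by
      ext c d
      simp [vecMulVec_apply, v, Matrix.single_apply]
      split_ifs <;> simp_all
    rw [h0]
    rfl
  have hX : ∀ X, Φ X = ∑ k, (Matrix.of fun x a => star (M k (a, x)) : Matrix m n ℂ) * X *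
      (Matrix.of fun x a => star (M k (a, x)) : Matrix m n ℂ)ᴴ := by
    intro X
    conv_lhs => rw [matrix_eq_sum_single X]
    ext x y
    have : ∀ a b, Matrix.single a b (X a b) = X a b • Matrix.single a b (1:ℂ) := by
      intro a b; simp
    simp only [this, map_sum, map_smul, Matrix.sum_apply, Matrix.smul_apply, hM', mul_apply,
      conjTranspose_apply, of_apply, star_star, smul_eq_mul, Finset.mul_sum, Finset.sum_mul]
    rw [Finset.sum_comm]
    rw [Finset.sum_congr rfl fun b _ => Finset.sum_comm]
    rw [Finset.sum_comm]
    refine Finset.sum_congr rfl fun k _ => Finset.sum_congr rfl fun b _ =>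
      Finset.sum_congr rfl fun a _ => ?_
    ring
  refine ⟨_, hX, ?_⟩
  ext a b
  have h1 := hTP (Matrix.single b a 1)
  rw [hX, trace_sum] at h1
  have h2 : ∀ (K : Matrix m n ℂ), (K * Matrix.single b a (1:ℂ) * Kᴴ).trace = (Kᴴ * K) a b := by
    intro K
    rw [trace_mul_comm, ← Matrix.mul_assoc, Matrix.trace_mul_single]
    simp
  simp only [h2] at h1
  rw [Matrix.sum_apply, h1, Matrix.one_apply]
  by_cases hab : a = b
  · simp [hab]
  · rw [if_neg hab, Matrix.trace_single_eq_of_ne _ _ _ (Ne.symm hab)]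

lemma dpi_schwarz {n m κ : Type*} [Fintype n] [DecidableEq n] [Fintype m] [DecidableEq m]
    [Fintype κ] (L : κ → Matrix m n ℂ) (hL : ∑ k, (L k)ᴴ * L k = 1)
    (τ : Matrix n n ℂ) (hτ : τ.PosSemidef) (Y : Matrix m m ℂ) :
    (τ * ((∑ k, (L k)ᴴ * Y * L k)ᴴ * (∑ k, (L k)ᴴ * Y * L k))).trace.re ≤
      ((∑ k, L k * τ * (L k)ᴴ) * (Yᴴ * Y)).trace.re := by
  set P := ∑ k, (L k)ᴴ * Y * L k with hP
  have hPs : Pᴴ = ∑ k, (L k)ᴴ * Yᴴ * L k := by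
    rw [hP, conjTranspose_sum]
    simp [Matrix.mul_assoc]
  have h1 : ∑ k, (Y * L k - L k * P)ᴴ * (Y * L k - L k * P) =
      (∑ k, (L k)ᴴ * (Yᴴ * Y) * L k) - Pᴴ * P := by
    have : ∀ k, (Y * L k - L k * P)ᴴ * (Y * L k - L k * P) =
        (L k)ᴴ * (Yᴴ * Y) * L k - ((L k)ᴴ * Yᴴ * L k) * P - Pᴴ * ((L k)ᴴ * Y * L k)
          + Pᴴ * ((L k)ᴴ * L k) * P := by
      intro k
      simp only [conjTranspose_sub, conjTranspose_mul, Matrix.sub_mul, Matrix.mul_sub,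
        Matrix.mul_assoc]
      abel
    simp only [this, Finset.sum_add_distrib, Finset.sum_sub_distrib, ← Finset.sum_mul,
      ← Finset.mul_sum, ← hPs, ← hP, hL]
    simp
  have h2 : (τ * (∑ k, (L k)ᴴ * (Yᴴ * Y) * L k)).trace =
      ((∑ k, L k * τ * (L k)ᴴ) * (Yᴴ * Y)).trace := by
    rw [Finset.sum_mul, Finset.mul_sum, trace_sum, trace_sum]
    refine Finset.sum_congr rfl fun k _ => ?_
    rw [← Matrix.mul_assoc, trace_mul_comm]
    simp only [Matrix.mul_assoc]
  have h3 : 0 ≤ (τ * ∑ k, (Y * L k - L k * P)ᴴ * (Y * L k - L k * P)).trace.re := by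
    rw [Finset.mul_sum, trace_sum, Complex.re_sum]
    refine Finset.sum_nonneg fun k _ => ?_
    rw [← Matrix.mul_assoc, trace_mul_comm, ← Matrix.mul_assoc]
    exact (Complex.le_def.mp (hτ.mul_mul_conjTranspose_same _).trace_nonneg).1
  rw [h1, Matrix.mul_sub, trace_sub, h2, Complex.sub_re] at h3
  linarith

lemma dpi_var {n : Type*} [Fintype n] [DecidableEq n]
    (U V : Matrix n n ℂ) (hU : U * Uᴴ = 1) (hV : V * Vᴴ = 1) (p q : n → ℝ)
    (X : Matrix n n ℂ) (t : ℝ) :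
    2 * (Xᴴ * (U * diagonal (fun i => (p i : ℂ)) * Uᴴ)).trace.re
      - ((V * diagonal (fun i => (q i : ℂ)) * Vᴴ) * (X * Xᴴ)).trace.re
      - t * ((U * diagonal (fun i => (p i : ℂ)) * Uᴴ) * (Xᴴ * X)).trace.re
    = ∑ j, ∑ i, (2 * (star ((Vᴴ * X * U) j i) * (Vᴴ * U) j i).re * p i
      - (q j + t * p i) * Complex.normSq ((Vᴴ * X * U) j i)) := by
  set Z := Vᴴ * X * U with hZ
  have hX : X = V * Z * Uᴴ := by
    rw [hZ]
    calc X = (V * Vᴴ) * X * (U * Uᴴ) := by rw [hU, hV]; simp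
      _ = _ := by simp only [Matrix.mul_assoc]
  have hU2 : Uᴴ * U = 1 := mul_eq_one_comm.mp hU
  have hV2 : Vᴴ * V = 1 := mul_eq_one_comm.mp hV
  have hU3 : ∀ M : Matrix n n ℂ, Uᴴ * (U * M) = M := fun M => by
    rw [← Matrix.mul_assoc, hU2, Matrix.one_mul]
  have hV3 : ∀ M : Matrix n n ℂ, Vᴴ * (V * M) = M := fun M => by
    rw [← Matrix.mul_assoc, hV2, Matrix.one_mul]
  have h1 : (Xᴴ * (U * diagonal (fun i => (p i : ℂ)) * Uᴴ)).trace =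
      ∑ j, ∑ i, star (Z j i) * (Vᴴ * U) j i * p i := by
    have : (Xᴴ * (U * diagonal (fun i => (p i : ℂ)) * Uᴴ)).trace =
        (Zᴴ * ((Vᴴ * U) * diagonal (fun i => (p i : ℂ)))).trace := by
      rw [hX]
      simp only [conjTranspose_mul, conjTranspose_conjTranspose, Matrix.mul_assoc]
      rw [trace_mul_comm]
      simp only [Matrix.mul_assoc, hU2, Matrix.mul_one]
    rw [this, Finset.sum_comm]
    simp only [trace, diag_apply, Matrix.mul_apply (M := Zᴴ), mul_diagonal, conjTranspose_apply]
    simp only [mul_assoc]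
  have h2 : ((V * diagonal (fun i => (q i : ℂ)) * Vᴴ) * (X * Xᴴ)).trace =
      ∑ j, ∑ i, (q j : ℂ) * Complex.normSq (Z j i) := by
    have : ((V * diagonal (fun i => (q i : ℂ)) * Vᴴ) * (X * Xᴴ)).trace =
        ((diagonal (fun i => (q i : ℂ)) * Z) * Zᴴ).trace := by
      rw [hX]
      simp only [conjTranspose_mul, conjTranspose_conjTranspose, Matrix.mul_assoc, hU3, hV3]
      rw [trace_mul_comm]
      simp only [Matrix.mul_assoc, hV2, Matrix.mul_one]
    rw [this]
    simp only [trace, diag_apply, Matrix.mul_apply (N := Zᴴ), diagonal_mul, conjTranspose_apply,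
      Complex.normSq_eq_conj_mul_self]
    refine Finset.sum_congr rfl fun j _ => Finset.sum_congr rfl fun i _ => ?_
    simp only [Complex.star_def]; ring
  have h3 : ((U * diagonal (fun i => (p i : ℂ)) * Uᴴ) * (Xᴴ * X)).trace =
      ∑ j, ∑ i, (p i : ℂ) * Complex.normSq (Z j i) := by
    have : ((U * diagonal (fun i => (p i : ℂ)) * Uᴴ) * (Xᴴ * X)).trace =
        ((diagonal (fun i => (p i : ℂ)) * Zᴴ) * Z).trace := by
      rw [hX]
      simp only [conjTranspose_mul, conjTranspose_conjTranspose, Matrix.mul_assoc, hU3, hV3]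
      rw [trace_mul_comm]
      simp only [Matrix.mul_assoc, hU2, Matrix.mul_one]
    rw [this, Finset.sum_comm]
    simp only [trace, diag_apply, Matrix.mul_apply (N := Z), diagonal_mul, conjTranspose_apply,
      Complex.normSq_eq_conj_mul_self]
    refine Finset.sum_congr rfl fun j _ => Finset.sum_congr rfl fun i _ => ?_
    simp only [Complex.star_def]; ring
  rw [h1, h2, h3]
  simp only [Complex.re_sum, Finset.mul_sum, ← Finset.sum_sub_distrib, Complex.re_mul_ofReal,
    Complex.re_ofReal_mul, Complex.ofReal_re]
  refine Finset.sum_congr rfl fun j _ => Finset.sum_congr rfl fun i _ => ?_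
  ring

lemma dpi_Q {n m κ : Type*} [Fintype n] [DecidableEq n] [Fintype m] [DecidableEq m]
    [Fintype κ] (L : κ → Matrix m n ℂ) (hL : ∑ k, (L k)ᴴ * L k = 1)
    (ρ τ : Matrix n n ℂ) (hρ : ρ.PosSemidef) (hτ : τ.PosSemidef)
    (U V : Matrix n n ℂ) (hU : U * Uᴴ = 1) (hV : V * Vᴴ = 1) (p q : n → ℝ)
    (hp : ∀ i, 0 ≤ p i) (hq : ∀ i, 0 ≤ q i)
    (hρe : ρ = U * diagonal (fun i => (p i : ℂ)) * Uᴴ)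
    (hτe : τ = V * diagonal (fun i => (q i : ℂ)) * Vᴴ)
    (U' V' : Matrix m m ℂ) (hU' : U' * U'ᴴ = 1) (hV' : V' * V'ᴴ = 1) (p' q' : m → ℝ)
    (hp' : ∀ i, 0 ≤ p' i) (hq' : ∀ i, 0 ≤ q' i)
    (hρe' : ∑ k, L k * ρ * (L k)ᴴ = U' * diagonal (fun i => (p' i : ℂ)) * U'ᴴ)
    (hτe' : ∑ k, L k * τ * (L k)ᴴ = V' * diagonal (fun i => (q' i : ℂ)) * V'ᴴ)
    (t : ℝ) (ht : 0 < t) :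
    ∑ j, ∑ i, (Complex.normSq ((V'ᴴ * U') j i) * p' i) * (p' i / (q' j + t * p' i)) ≤
    ∑ j, ∑ i, (Complex.normSq ((Vᴴ * U) j i) * p i) * (p i / (q j + t * p i)) := by
  set W' := V'ᴴ * U' with hW'
  set Z' : Matrix m m ℂ := fun j i => ((p' i / (q' j + t * p' i) : ℝ) : ℂ) * W' j i with hZ'
  set Y := V' * Z' * U'ᴴ with hY
  set X := ∑ k, (L k)ᴴ * Y * L k with hX
  have hV'2 : V'ᴴ * V' = 1 := mul_eq_one_comm.mp hV'
  have hU'2 : U'ᴴ * U' = 1 := mul_eq_one_comm.mp hU'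
  have hZY : V'ᴴ * Y * U' = Z' := by
    rw [hY]
    calc _ = (V'ᴴ * V') * Z' * (U'ᴴ * U') := by simp only [Matrix.mul_assoc]
      _ = Z' := by rw [hV'2, hU'2]; simp
  have e1 := dpi_var U' V' hU' hV' p' q' Y t
  have e2 := dpi_var U V hU hV p q X t
  rw [← hρe', ← hτe', hZY] at e1
  rw [← hρe, ← hτe] at e2
  have s1 := dpi_schwarz L hL ρ hρ Y
  have s2 := dpi_schwarz L hL τ hτ Yᴴ
  have hXs : (∑ k, (L k)ᴴ * Yᴴ * L k) = Xᴴ := by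
    rw [hX, conjTranspose_sum]
    simp [Matrix.mul_assoc]
  rw [hXs] at s2
  simp only [conjTranspose_conjTranspose] at s2
  have s3 : (Xᴴ * ρ).trace = (Yᴴ * ∑ k, L k * ρ * (L k)ᴴ).trace := by
    rw [← hXs, Finset.sum_mul, Finset.mul_sum, trace_sum, trace_sum]
    refine Finset.sum_congr rfl fun k _ => ?_
    simp only [Matrix.mul_assoc]
    rw [trace_mul_comm]
    simp only [Matrix.mul_assoc]
  have l1 : ∑ j, ∑ i, (Complex.normSq (W' j i) * p' i) * (p' i / (q' j + t * p' i)) =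
      ∑ j, ∑ i, (2 * (star (Z' j i) * W' j i).re * p' i
      - (q' j + t * p' i) * Complex.normSq (Z' j i)) := by
    refine Finset.sum_congr rfl fun j _ => Finset.sum_congr rfl fun i _ => ?_
    have : (star (Z' j i) * W' j i).re = p' i / (q' j + t * p' i) * Complex.normSq (W' j i) := by
      simp only [hZ']
      generalize p' i / (q' j + t * p' i) = r
      simp [Complex.normSq_apply]; ring
    rw [this]
    have : Complex.normSq (Z' j i) = (p' i / (q' j + t * p' i))^2 * Complex.normSq (W' j i) := by
      simp only [hZ', Complex.normSq_mul, Complex.normSq_ofReal]; ring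
    rw [this]
    by_cases h0 : q' j + t * p' i = 0
    · simp [h0]
    · field_simp; ring
  have l2 : ∑ j, ∑ i, (2 * (star ((Vᴴ * X * U) j i) * (Vᴴ * U) j i).re * p i
      - (q j + t * p i) * Complex.normSq ((Vᴴ * X * U) j i)) ≤
      ∑ j, ∑ i, (Complex.normSq ((Vᴴ * U) j i) * p i) * (p i / (q j + t * p i)) := by
    refine Finset.sum_le_sum fun j _ => Finset.sum_le_sum fun i _ => ?_
    generalize (Vᴴ * X * U) j i = z
    generalize (Vᴴ * U) j i = w
    have hpi := hp i
    have hqj := hq j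
    rcases hpi.eq_or_lt with h0 | h0
    · rw [← h0]; simp; exact mul_nonneg hqj (Complex.normSq_nonneg _)
    · have hd : 0 < q j + t * p i := by positivity
      have : Complex.normSq w * p i * (p i / (q j + t * p i)) -
        (2 * (star z * w).re * p i - (q j + t * p i) * Complex.normSq z) =
        (((q j + t * p i) * z.re - p i * w.re)^2 + ((q j + t * p i) * z.im - p i * w.im)^2) / (q j + t * p i) := by
        simp [Complex.normSq_apply]
        field_simp
        ring
      have h2 : 0 ≤ (((q j + t * p i) * z.re - p i * w.re)^2 + ((q j + t * p i) * z.im - p i * w.im)^2) / (q j + t * p i) := by positivity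
      linarith
  rw [l1, ← e1]
  refine le_trans ?_ l2
  rw [← e2, s3]
  have := mul_le_mul_of_nonneg_left s1 ht.le
  linarith

lemma dpi_spec {n : Type*} [Fintype n] [DecidableEq n] (ρ : Matrix n n ℂ) (h : ρ.PosSemidef) :
    ∃ (U : Matrix n n ℂ) (p : n → ℝ), U * Uᴴ = 1 ∧ (∀ i, 0 ≤ p i) ∧
      ρ = U * diagonal (fun i => (p i : ℂ)) * Uᴴ ∧
      vNEntropy ρ = -∑ i, p i * Real.log (p i) := by
  refine ⟨h.1.eigenvectorUnitary, h.1.eigenvalues, ?_, h.eigenvalues_nonneg, ?_, ?_⟩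
  · exact Matrix.mem_unitaryGroup_iff.mp h.1.eigenvectorUnitary.2
  · have := h.1.spectral_theorem
    exact this
  · simp [vNEntropy, h.1]

lemma dpi_ptrace {A B : Type*} [Fintype A] [DecidableEq A] [Fintype B] [DecidableEq B]
    (ρ : Matrix (A × B) (A × B) ℂ) (h : ρ.PosSemidef) :
    (Matrix.of fun b b' => ∑ a : A, ρ (a, b) (a, b') : Matrix B B ℂ).PosSemidef := by
  have : (Matrix.of fun b b' => ∑ a : A, ρ (a, b) (a, b') : Matrix B B ℂ) =
      ∑ a : A, ρ.submatrix (fun b => (a, b)) (fun b => (a, b)) := by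
    ext b b'; simp [Matrix.sum_apply]
  rw [this]
  exact posSemidef_sum _ fun a _ => h.submatrix _

lemma dpi_state {A B : Type*} [Fintype A] [DecidableEq A] [Fintype B] [DecidableEq B]
    (ρ : Matrix (A × B) (A × B) ℂ) (h : ρ.PosSemidef) (ρB : Matrix B B ℂ)
    (hB : ρB = fun b b' => ∑ a : A, ρ (a, b) (a, b')) :
    ((1 : Matrix A A ℂ) ⊗ₖ ρB).PosSemidef ∧
    ∃ (U V : Matrix (A × B) (A × B) ℂ) (p q : A × B → ℝ), U * Uᴴ = 1 ∧ V * Vᴴ = 1 ∧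
      (∀ i, 0 ≤ p i) ∧ (∀ i, 0 ≤ q i) ∧
      ρ = U * diagonal (fun i => (p i : ℂ)) * Uᴴ ∧
      (1 : Matrix A A ℂ) ⊗ₖ ρB = V * diagonal (fun i => (q i : ℂ)) * Vᴴ ∧
      (∀ j i, Complex.normSq ((Vᴴ * U) j i) * p i ≠ 0 → 0 < p i ∧ 0 < q j) ∧
      (∑ j, ∑ i, Complex.normSq ((Vᴴ * U) j i) * p i = ρ.trace.re) ∧
      (∑ j, ∑ i, Complex.normSq ((Vᴴ * U) j i) * p i * (Real.log (p i) - Real.log (q j)) =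
        vNEntropy ρB - vNEntropy ρ) := by
  have hBp : ρB.PosSemidef := by rw [hB]; exact dpi_ptrace ρ h
  refine ⟨PosSemidef.one.kronecker hBp, ?_⟩
  obtain ⟨U, p, hU, hp, hρe, hS⟩ := dpi_spec ρ h
  obtain ⟨UB, r, hUB, hr, hBe, hSB⟩ := dpi_spec ρB hBp
  have hUB2 : UBᴴ * UB = 1 := mul_eq_one_comm.mp hUB
  have hU2 : Uᴴ * U = 1 := mul_eq_one_comm.mp hU
  set V := (1 : Matrix A A ℂ) ⊗ₖ UB with hVdef
  have hVs : Vᴴ = (1 : Matrix A A ℂ) ⊗ₖ UBᴴ := by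
    rw [hVdef, conjTranspose_kronecker, conjTranspose_one]
  have hV : V * Vᴴ = 1 := by
    rw [hVs, hVdef, ← mul_kronecker_mul, hUB, Matrix.one_mul, one_kronecker_one]
  set W := Vᴴ * U with hW
  set c : A × B → A × B → ℝ := fun j i => Complex.normSq (W j i) * p i with hc
  have hc0 : ∀ j i, 0 ≤ c j i := fun j i => mul_nonneg (Complex.normSq_nonneg _) (hp i)
  have hWW : Wᴴ * W = 1 := by
    rw [hW, conjTranspose_mul, conjTranspose_conjTranspose]
    calc _ = Uᴴ * (V * Vᴴ) * U := by simp only [Matrix.mul_assoc]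
      _ = 1 := by rw [hV, Matrix.mul_one, hU2]
  have hcol : ∀ i, ∑ j, c j i = p i := by
    intro i
    simp only [hc, ← Finset.sum_mul]
    have h1 := congrFun (congrFun hWW i) i
    simp only [mul_apply, conjTranspose_apply, one_apply_eq] at h1
    have : ((∑ j, Complex.normSq (W j i) : ℝ) : ℂ) = 1 := by
      rw [← h1]; push_cast
      exact Finset.sum_congr rfl fun j _ => Complex.normSq_eq_conj_mul_self
    rw [Complex.ofReal_eq_one.mp this, one_mul]
  have hrow : ∀ b, ∑ a, ∑ i, c (a, b) i = r b := by
    intro b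
    have h1 : ∀ j, ((∑ i, c j i : ℝ) : ℂ) = (Vᴴ * ρ * V) j j := by
      intro j
      have : Vᴴ * ρ * V = W * diagonal (fun i => (p i : ℂ)) * Wᴴ := by
        rw [hρe, hW, conjTranspose_mul, conjTranspose_conjTranspose]
        simp only [Matrix.mul_assoc]
      rw [this, mul_apply]
      simp only [mul_diagonal, conjTranspose_apply]
      push_cast
      refine Finset.sum_congr rfl fun i _ => ?_
      rw [hc]; push_cast
      rw [Complex.normSq_eq_conj_mul_self, Complex.star_def]; ring
    have h2 : ∑ a, (Vᴴ * ρ * V) (a, b) (a, b) = (UBᴴ * ρB * UB) b b := by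
      have hBa : ∀ b b', ρB b b' = ∑ a : A, ρ (a, b) (a, b') := fun b b' => by rw [hB]
      rw [hVs, hVdef]
      simp only [mul_apply, Fintype.sum_prod_type, kroneckerMap_apply, one_apply, ite_mul, mul_ite,
        one_mul, zero_mul, mul_zero, Finset.sum_ite_irrel, Finset.sum_const_zero, Finset.sum_ite_eq,
        Finset.sum_ite_eq', Finset.mem_univ, if_true, Finset.sum_mul, Finset.mul_sum, hBa]
      rw [Finset.sum_comm]
      refine Finset.sum_congr rfl fun x _ => ?_
      rw [Finset.sum_comm]
    have h3 : UBᴴ * ρB * UB = diagonal (fun i => (r i : ℂ)) := by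
      rw [hBe]
      calc _ = (UBᴴ * UB) * diagonal (fun i => (r i : ℂ)) * (UBᴴ * UB) := by
            simp only [Matrix.mul_assoc]
        _ = _ := by rw [hUB2]; simp
    have h4 : ((∑ a, ∑ i, c (a, b) i : ℝ) : ℂ) = r b := by
      rw [Complex.ofReal_sum]
      rw [Finset.sum_congr rfl fun a _ => h1 (a, b), h2, h3, diagonal_apply_eq]
    exact_mod_cast h4
  refine ⟨U, V, p, fun j => r j.2, hU, hV, hp, fun i => hr _, hρe, ?_, ?_, ?_, ?_⟩
  · have : diagonal (fun i : A × B => (r i.2 : ℂ)) =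
        (1 : Matrix A A ℂ) ⊗ₖ diagonal (fun i => (r i : ℂ)) := by
      rw [← diagonal_one, diagonal_kronecker_diagonal]
      simp
    rw [this, hVs, hVdef, ← mul_kronecker_mul, ← mul_kronecker_mul, ← hBe]
    simp
  · intro j i hne
    refine ⟨(hp i).lt_of_ne' fun h0 => hne (by simp [h0]), (hr _).lt_of_ne' fun h0 => hne ?_⟩
    have h1 := hrow j.2
    rw [h0, Finset.sum_eq_zero_iff_of_nonneg
      (fun a _ => Finset.sum_nonneg fun i _ => hc0 _ _)] at h1
    have h2 := h1 j.1 (Finset.mem_univ _)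
    rw [Finset.sum_eq_zero_iff_of_nonneg (fun i _ => hc0 _ _)] at h2
    exact h2 i (Finset.mem_univ _)
  · change ∑ j, ∑ i, c j i = _
    rw [Finset.sum_comm, Finset.sum_congr rfl fun i _ => hcol i, hρe, trace_mul_comm,
      ← Matrix.mul_assoc, hU2, Matrix.one_mul, trace_diagonal, Complex.re_sum]
    simp
  · change ∑ j, ∑ i, c j i * _ = _
    simp only [mul_sub, Finset.sum_sub_distrib]
    have h1 : ∑ j, ∑ i, c j i * Real.log (p i) = ∑ i, p i * Real.log (p i) := by
      rw [Finset.sum_comm]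
      simp only [← Finset.sum_mul, hcol]
    have h2 : ∑ j, ∑ i, c j i * Real.log (r j.2) = ∑ b, r b * Real.log (r b) := by
      rw [Fintype.sum_prod_type, Finset.sum_comm]
      simp only [← Finset.sum_mul, hrow]
    rw [hS, hSB, h1, h2]; ring

lemma dpi_block {A B B' : Type*} [Fintype A] [DecidableEq A] [Fintype B] [DecidableEq B]
    [Fintype B'] [DecidableEq B'] (K : Matrix B' B ℂ) (ρ : Matrix (A × B) (A × B) ℂ)
    (x y : A × B') :
    (((1 : Matrix A A ℂ) ⊗ₖ K) * ρ * ((1 : Matrix A A ℂ) ⊗ₖ K)ᴴ) x y =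
      (K * (Matrix.of fun b c => ρ (x.1, b) (y.1, c) : Matrix B B ℂ) * Kᴴ) x.2 y.2 := by
  rw [conjTranspose_kronecker, conjTranspose_one]
  simp only [mul_apply, Fintype.sum_prod_type, kroneckerMap_apply, one_apply, ite_mul, mul_ite,
    one_mul, zero_mul, mul_zero, Finset.sum_ite_irrel, Finset.sum_const_zero, Finset.sum_ite_eq,
    Finset.sum_ite_eq', Finset.mem_univ, if_true, of_apply]

theorem mutual_info_data_processing
    {A B B' : Type*} [Fintype A] [DecidableEq A] [Fintype B] [DecidableEq B]
    [Fintype B'] [DecidableEq B']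
    (ρ : Matrix (A × B) (A × B) ℂ) (hρ : IsDensityMatrix ρ)
    (Φ : Matrix B B ℂ →ₗ[ℂ] Matrix B' B' ℂ)
    (hCP : IsCompletelyPositive Φ) (hTP : IsTracePreserving Φ) :
    (let σ : Matrix (A × B') (A × B') ℂ := fun p q =>
      Φ (fun b c => ρ (p.1, b) (q.1, c)) p.2 q.2
    let ρA : Matrix A A ℂ := fun a a' => ∑ b : B, ρ (a, b) (a', b)
    let ρB : Matrix B B ℂ := fun b b' => ∑ a : A, ρ (a, b) (a, b')
    let σA : Matrix A A ℂ := fun a a' => ∑ b' : B', σ (a, b') (a', b')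
    let σB : Matrix B' B' ℂ := fun b b' => ∑ a : A, σ (a, b) (a, b')
    vNEntropy σA + vNEntropy σB - vNEntropy σ
      ≤ vNEntropy ρA + vNEntropy ρB - vNEntropy ρ) := by
  intro σ ρA ρB σA σB
  have hA : σA = ρA := by
    ext a a'
    exact hTP (fun b c => ρ (a, b) (a', c))
  obtain ⟨K, hK, hK1⟩ := dpi_kraus Φ hCP hTP
  set L : B × B' → Matrix (A × B') (A × B) ℂ := fun k => (1 : Matrix A A ℂ) ⊗ₖ K k with hLdef
  have hL : ∑ k, (L k)ᴴ * L k = 1 := by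
    simp only [hLdef, conjTranspose_kronecker, conjTranspose_one, ← mul_kronecker_mul,
      Matrix.mul_one]
    ext x y
    have := congrFun (congrFun hK1 x.2) y.2
    rw [Matrix.sum_apply] at this
    simp only [Matrix.sum_apply, kroneckerMap_apply, ← Finset.mul_sum, this]
    rw [← one_kronecker_one, kroneckerMap_apply]
  have hσ : ∑ k, L k * ρ * (L k)ᴴ = σ := by
    ext x y
    rw [Matrix.sum_apply]
    have := congrFun (congrFun (hK (Matrix.of fun b c => ρ (x.1, b) (y.1, c))) x.2) y.2
    rw [Matrix.sum_apply] at this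
    simp only [hLdef, dpi_block]
    exact this.symm
  have hσB : Φ ρB = σB := by
    have : ρB = ∑ a, (Matrix.of fun b c => ρ (a, b) (a, c) : Matrix B B ℂ) := by
      ext b c; simp [ρB, Matrix.sum_apply]
    rw [this, map_sum]
    ext b c
    rw [Matrix.sum_apply]
    rfl
  have hτ : ∑ k, L k * ((1 : Matrix A A ℂ) ⊗ₖ ρB) * (L k)ᴴ = (1 : Matrix A A ℂ) ⊗ₖ σB := by
    simp only [hLdef, conjTranspose_kronecker, conjTranspose_one, ← mul_kronecker_mul,
      Matrix.mul_one]
    ext x y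
    rw [← hσB, hK]
    simp only [Matrix.sum_apply, kroneckerMap_apply, ← Finset.mul_sum]
  have hσp : σ.PosSemidef := by
    rw [← hσ]
    exact posSemidef_sum _ fun k _ => hρ.1.mul_mul_conjTranspose_same _
  have htr : σ.trace = ρ.trace := by
    rw [← hσ, trace_sum]
    have : ∀ k, (L k * ρ * (L k)ᴴ).trace = (((L k)ᴴ * L k) * ρ).trace := by
      intro k
      rw [trace_mul_comm, Matrix.mul_assoc]
    simp only [this]
    rw [← trace_sum, ← Finset.sum_mul, hL, Matrix.one_mul]
  obtain ⟨hτp, U, V, p, q, hU, hV, hp, hq, e1, e2, hs, ht, hD⟩ := dpi_state ρ hρ.1 ρB rfl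
  obtain ⟨-, U', V', p', q', hU', hV', hp', hq', e1', e2', hs', ht', hD'⟩ :=
    dpi_state σ hσp σB rfl
  have Q := dpi_Q L hL ρ _ hρ.1 hτp U V hU hV p q hp hq e1 e2 U' V' hU' hV' p' q' hp' hq'
    (hσ.trans e1') (hτ.trans e2')
  have main := dpi_analysis
    (fun x : (A × B) × (A × B) => Complex.normSq ((Vᴴ * U) x.1 x.2) * p x.2)
    (fun x => p x.2) (fun x => q x.1)
    (fun x : (A × B') × (A × B') => Complex.normSq ((V'ᴴ * U') x.1 x.2) * p' x.2)
    (fun x => p' x.2) (fun x => q' x.1) (fun x => hs x.1 x.2) (fun x => hs' x.1 x.2)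
    (by rw [Fintype.sum_prod_type, ht, Fintype.sum_prod_type, ht', htr])
    (fun t h0 => by
      rw [Fintype.sum_prod_type, Fintype.sum_prod_type (α₁ := A × B)]
      exact Q t h0)
  rw [Fintype.sum_prod_type, Fintype.sum_prod_type (α₁ := A × B)] at main
  simp only at main
  rw [hD, hD'] at main
  rw [hA]
  linarith
end
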